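/- Let T : ℋⁿ → ℋⁿ be an ℝ-linear map. Let S = {λ(|T(P∘ε)|) : P a nonzero projection in ℋⁿ, ε an involution in ℋⁿ} ∪ {λ(|T*(P∘ε)|) : P a nonzero projection in ℋⁿ, ε an involution in ℋⁿ} and let Q = {q ∈ (ℝⁿ₊)↓ : λ(|T(X)|) ≺_w q*λ(|X|) for all X ∈ ℋⁿ}. Then Q is nonempty, S is nonempty and bounded, w-sup(S) ∈ Q, and w-sup(S) = w-inf(Q). -/

import Mathlib

open Matrix
open scoped ComplexOrder

/-- Sum of the `k` largest entries of `p` (as a supremum of sums over `k`-subsets). -/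
noncomputable def sumLargest {n : ℕ} (p : Fin n → ℝ) (k : ℕ) : ℝ :=
  sSup ((fun A : Finset (Fin n) => ∑ i ∈ A, p i) '' {A : Finset (Fin n) | A.card = k})

/-- `p` is weakly majorized by `q`. -/
def WeakMaj {n : ℕ} (p q : Fin n → ℝ) : Prop :=
  ∀ k : ℕ, 1 ≤ k → k ≤ n → sumLargest p k ≤ sumLargest q k

/-- `p` is majorized by `q`. -/
def Maj {n : ℕ} (p q : Fin n → ℝ) : Prop :=
  WeakMaj p q ∧ ∑ i, p i = ∑ i, q i

/-- `p` has nonnegative entries arranged in decreasing order. -/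
def DecrNonneg {n : ℕ} (p : Fin n → ℝ) : Prop :=
  Antitone p ∧ ∀ i, 0 ≤ p i

/-- The decreasing rearrangement of a vector. -/
noncomputable def decrRearrange {n : ℕ} (p : Fin n → ℝ) : Fin n → ℝ :=
  fun i => p (Tuple.sort p (Fin.rev i))

/-- `x` is the supremum of `S` in the weak-majorization order (w-sup). -/
def IsWSup {n : ℕ} (S : Set (Fin n → ℝ)) (x : Fin n → ℝ) : Prop :=
  DecrNonneg x ∧ (∀ s ∈ S, WeakMaj s x) ∧
    ∀ p : Fin n → ℝ, (∀ i, 0 ≤ p i) → (∀ s ∈ S, WeakMaj s p) → WeakMaj x p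

/-- `x` is the infimum of `Q` in the weak-majorization order (w-inf). -/
def IsWInf {n : ℕ} (Q : Set (Fin n → ℝ)) (x : Fin n → ℝ) : Prop :=
  DecrNonneg x ∧ (∀ q ∈ Q, WeakMaj x q) ∧
    ∀ p : Fin n → ℝ, (∀ i, 0 ≤ p i) → (∀ q ∈ Q, WeakMaj p q) → WeakMaj p x

open Classical in
/-- The vector of eigenvalues of a Hermitian matrix, in decreasing order
(junk value `0` if the matrix is not Hermitian). -/
noncomputable def specVec {n : ℕ} (X : Matrix (Fin n) (Fin n) ℂ) : Fin n → ℝ :=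
  if h : X.IsHermitian then decrRearrange h.eigenvalues else 0

open Classical in
/-- `λ(|X|)`: the absolute values of the eigenvalues of a Hermitian matrix `X`,
in decreasing order. -/
noncomputable def absSpecVec {n : ℕ} (X : Matrix (Fin n) (Fin n) ℂ) : Fin n → ℝ :=
  if h : X.IsHermitian then decrRearrange (fun i => |h.eigenvalues i|) else 0

/-- The Jordan product `X ∘ Y = (XY + YX)/2`. -/
noncomputable def jmul {n : ℕ} (X Y : Matrix (Fin n) (Fin n) ℂ) : Matrix (Fin n) (Fin n) ℂ :=
  (2 : ℂ)⁻¹ • (X * Y + Y * X)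

/-- A nonzero (orthogonal) projection in `ℋⁿ`. -/
def IsProjection {n : ℕ} (P : Matrix (Fin n) (Fin n) ℂ) : Prop :=
  P.IsHermitian ∧ P * P = P ∧ P ≠ 0

/-- An involution in `ℋⁿ`: a Hermitian matrix with `ε² = I`. -/
def IsInvolution {n : ℕ} (ε : Matrix (Fin n) (Fin n) ℂ) : Prop :=
  ε.IsHermitian ∧ ε * ε = 1

/-- A positive map: maps positive semidefinite matrices to positive semidefinite matrices. -/
def PositiveMap {n : ℕ} (T : Matrix (Fin n) (Fin n) ℂ → Matrix (Fin n) (Fin n) ℂ) : Prop :=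
  ∀ X : Matrix (Fin n) (Fin n) ℂ, X.PosSemidef → (T X).PosSemidef

/-- `S` is the adjoint of `T` with respect to the trace inner product on `ℋⁿ`. -/
def IsAdjointOf {n : ℕ} (S T : Matrix (Fin n) (Fin n) ℂ → Matrix (Fin n) (Fin n) ℂ) : Prop :=
  ∀ X Y : Matrix (Fin n) (Fin n) ℂ, X.IsHermitian → Y.IsHermitian →
    Matrix.trace (T X * Y) = Matrix.trace (X * S Y)

/-- `q` is the least vector of `T`: `λ(|T(X)|) ≺_w q * λ(|X|)` for all Hermitian `X`,
and `q ≺_w q'` for any other `q' ∈ (ℝⁿ₊)↓` with the same property. -/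
def IsLeastVector {n : ℕ} (T : Matrix (Fin n) (Fin n) ℂ → Matrix (Fin n) (Fin n) ℂ)
    (q : Fin n → ℝ) : Prop :=
  DecrNonneg q ∧
  (∀ X : Matrix (Fin n) (Fin n) ℂ, X.IsHermitian →
    WeakMaj (absSpecVec (T X)) (q * absSpecVec X)) ∧
  ∀ q' : Fin n → ℝ, DecrNonneg q' →
    (∀ X : Matrix (Fin n) (Fin n) ℂ, X.IsHermitian →
      WeakMaj (absSpecVec (T X)) (q' * absSpecVec X)) → WeakMaj q q'

/-- The set `Λ ∪ Λ*` of vectors `λ(|T(P∘ε)|)` and `λ(|T*(P∘ε)|)`. -/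
def lambdaSet {n : ℕ} (T T' : Matrix (Fin n) (Fin n) ℂ → Matrix (Fin n) (Fin n) ℂ) : Set (Fin n → ℝ) :=
  {s | ∃ P ε : Matrix (Fin n) (Fin n) ℂ, IsProjection P ∧ IsInvolution ε ∧
    (s = absSpecVec (T (jmul P ε)) ∨ s = absSpecVec (T' (jmul P ε)))}

/-- The set `Q` of decreasing nonnegative vectors `q` satisfying the pointwise
weak-majorization inequality for `T`. -/
def ineqSet {n : ℕ} (T : Matrix (Fin n) (Fin n) ℂ → Matrix (Fin n) (Fin n) ℂ) : Set (Fin n → ℝ) :=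
  {q | DecrNonneg q ∧ ∀ X : Matrix (Fin n) (Fin n) ℂ, X.IsHermitian →
    WeakMaj (absSpecVec (T X)) (q * absSpecVec X)}

/-- Sum of the first `k` entries of `p`. -/
def partialSum {n : ℕ} (p : Fin n → ℝ) (k : ℕ) : ℝ :=
  ∑ i : Fin n, if (i : ℕ) < k then p i else 0

lemma partialSum_eq_sum_range {n : ℕ} (f : ℕ → ℝ) {k : ℕ} (hk : k ≤ n) :
    partialSum (fun i : Fin n => f i) k = ∑ i ∈ Finset.range k, f i := by
  unfold partialSum
  rw [Fin.sum_univ_eq_sum_range (fun i => if i < k then f i else 0) n, ← Finset.sum_filter]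
  congr 1
  ext i
  simp only [Finset.mem_filter, Finset.mem_range]
  omega

lemma partialSum_one {n k : ℕ} (hk : k ≤ n) : partialSum (fun _ : Fin n => 1) k = k := by
  rw [partialSum_eq_sum_range (fun _ => 1) hk]
  simp

lemma partialSum_self {n : ℕ} (p : Fin n → ℝ) : partialSum p n = ∑ i, p i := by
  simp [partialSum]

lemma partialSum_nonneg {n : ℕ} {p : Fin n → ℝ} (hp : ∀ i, 0 ≤ p i) (k : ℕ) :
    0 ≤ partialSum p k := by
  refine Finset.sum_nonneg fun i _ => ?_
  split_ifs
  exacts [hp i, le_rfl]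

lemma partialSum_mono {n : ℕ} {p q : Fin n → ℝ} (h : ∀ i, p i ≤ q i) (k : ℕ) :
    partialSum p k ≤ partialSum q k := by
  refine Finset.sum_le_sum fun i _ => ?_
  split_ifs
  exacts [h i, le_rfl]

lemma partialSum_succ {n : ℕ} (p : Fin n → ℝ) (i : Fin n) :
    partialSum p (i + 1) = partialSum p i + p i := by
  have h : ∀ j : Fin n, (if (j : ℕ) < i + 1 then p j else 0)
      = (if (j : ℕ) < i then p j else 0) + if j = i then p j else 0 := by
    intro j
    rcases lt_trichotomy j i with h | h | h
    · have h' : (j : ℕ) < i := h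
      simp [h', h.ne, Nat.lt_succ_of_lt h']
    · simp [h]
    · have h' : (i : ℕ) < j := h
      simp [h.ne', not_lt.mpr h'.le, not_lt.mpr (Nat.succ_le_of_lt h')]
  simp only [partialSum, h, Finset.sum_add_distrib]
  simp

/-- Among all weights in `[0, 1]` of total mass at most `k`, the indicator of the first `k`
indices maximizes the weighted sum of a decreasing nonnegative vector. -/
lemma sum_mul_le_partialSum {n k : ℕ} (hk : k ≤ n) {a w : Fin n → ℝ} (ha : DecrNonneg a)
    (hw0 : ∀ i, 0 ≤ w i) (hw1 : ∀ i, w i ≤ 1) (hw : ∑ i, w i ≤ k) :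
    ∑ i, a i * w i ≤ partialSum a k := by
  rcases Nat.eq_zero_or_pos k with rfl | hk0
  · have hz : ∀ i ∈ Finset.univ, w i = 0 :=
      (Finset.sum_eq_zero_iff_of_nonneg fun i _ => hw0 i).mp
        (le_antisymm (by simpa using hw) (Finset.sum_nonneg fun i _ => hw0 i))
    simp [partialSum, hz]
  · set c := a ⟨k - 1, by omega⟩ with hc
    have hpt : ∀ i : Fin n, a i * w i + c * ((if (i : ℕ) < k then 1 else 0) - w i)
        ≤ if (i : ℕ) < k then a i else 0 := by
      intro i
      split_ifs with h
      · have : c ≤ a i := ha.1 (Fin.le_def.mpr (by simp only; omega))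
        nlinarith [hw1 i]
      · have : a i ≤ c := ha.1 (Fin.le_def.mpr (by simp only; omega))
        nlinarith [hw0 i]
    have hsum := Finset.sum_le_sum fun i (_ : i ∈ Finset.univ) => hpt i
    rw [Finset.sum_add_distrib, ← Finset.mul_sum, Finset.sum_sub_distrib] at hsum
    have h1 : ∑ i : Fin n, (if (i : ℕ) < k then (1 : ℝ) else 0) = k := partialSum_one hk
    rw [h1] at hsum
    have hcn : 0 ≤ c := ha.2 _
    have : 0 ≤ c * (k - ∑ i, w i) := mul_nonneg hcn (by linarith)
    unfold partialSum
    linarith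

lemma sumLargest_of_decrNonneg {n k : ℕ} (hk : k ≤ n) {p : Fin n → ℝ} (hp : DecrNonneg p) :
    sumLargest p k = partialSum p k := by
  refine IsGreatest.csSup_eq ⟨?_, ?_⟩
  · refine ⟨Finset.univ.filter fun i : Fin n => (i : ℕ) < k, ?_, ?_⟩
    · have h := partialSum_one hk
      simp only [partialSum, Finset.sum_boole] at h
      exact_mod_cast h
    · simp only [partialSum, Finset.sum_filter]
  · rintro _ ⟨A, hA, rfl⟩
    have h := sum_mul_le_partialSum hk hp (w := fun i => if i ∈ A then 1 else 0)
      (fun i => by split_ifs <;> norm_num) (fun i => by split_ifs <;> norm_num)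
      (by simp only [Finset.sum_boole, Finset.filter_univ_mem]; exact_mod_cast hA.le)
    simpa using h

lemma weakMaj_iff_partialSum {n : ℕ} {p q : Fin n → ℝ} (hp : DecrNonneg p) (hq : DecrNonneg q) :
    WeakMaj p q ↔ ∀ k : ℕ, 1 ≤ k → k ≤ n → partialSum p k ≤ partialSum q k := by
  refine forall_congr' fun k => forall_congr' fun _ => forall_congr' fun hk => ?_
  rw [sumLargest_of_decrNonneg hk hp, sumLargest_of_decrNonneg hk hq]

lemma DecrNonneg.mul {n : ℕ} {p q : Fin n → ℝ} (hp : DecrNonneg p) (hq : DecrNonneg q) :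
    DecrNonneg (p * q) :=
  ⟨fun _ j h => mul_le_mul (hp.1 h) (hq.1 h) (hq.2 j) (hp.2 _),
    fun i => mul_nonneg (hp.2 i) (hq.2 i)⟩

lemma sumLargest_comp_perm {n : ℕ} (p : Fin n → ℝ) (π : Equiv.Perm (Fin n)) (k : ℕ) :
    sumLargest (p ∘ π) k = sumLargest p k := by
  unfold sumLargest
  congr 1
  ext x
  constructor
  · rintro ⟨A, hA, rfl⟩
    exact ⟨A.map π.toEmbedding, by simpa using hA, by simp⟩
  · rintro ⟨A, hA, rfl⟩
    exact ⟨A.map π.symm.toEmbedding, by simpa using hA, by simp⟩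

lemma decrRearrange_eq_comp {n : ℕ} (p : Fin n → ℝ) :
    decrRearrange p = p ∘ (Fin.revPerm.trans (Tuple.sort p)) := rfl

lemma decrNonneg_decrRearrange {n : ℕ} {p : Fin n → ℝ} (hp : ∀ i, 0 ≤ p i) :
    DecrNonneg (decrRearrange p) :=
  ⟨fun _ _ h => Tuple.monotone_sort p (Fin.rev_le_rev.mpr h), fun _ => hp _⟩

lemma weakMaj_decrRearrange_right {n : ℕ} {p q : Fin n → ℝ} :
    WeakMaj p (decrRearrange q) ↔ WeakMaj p q := by
  simp only [WeakMaj, decrRearrange_eq_comp, sumLargest_comp_perm]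

/-- If the set of decreasing nonnegative weak-majorization upper bounds of `S` is nonempty,
then `S` has a supremum, and this supremum is an upper bound and the infimum of all of them. -/
lemma exists_isWSup_isWInf {n : ℕ} {S U : Set (Fin n → ℝ)} (hS : ∀ s ∈ S, DecrNonneg s)
    (hU : ∀ q, q ∈ U ↔ DecrNonneg q ∧ ∀ s ∈ S, WeakMaj s q) (hne : U.Nonempty) :
    ∃ x, IsWSup S x ∧ x ∈ U ∧ IsWInf U x := by
  have hUd : ∀ q ∈ U, DecrNonneg q := fun q hq => ((hU q).mp hq).1
  have : Nonempty U := hne.to_subtype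
  set g : ℕ → ℝ := fun k => ⨅ q : U, partialSum q.1 k with hg
  have hbdd : ∀ k, BddBelow (Set.range fun q : U => partialSum q.1 k) := fun k =>
    ⟨0, by rintro _ ⟨q, rfl⟩; exact partialSum_nonneg (hUd _ q.2).2 k⟩
  have hgle : ∀ k, ∀ q ∈ U, g k ≤ partialSum q k := fun k q hq => ciInf_le (hbdd k) ⟨q, hq⟩
  have hg0 : g 0 = 0 := by simp [hg, partialSum]
  have hmono : ∀ i : Fin n, g i ≤ g (i + 1) := fun i => le_ciInf fun q => by
    have := (hUd _ q.2).2 i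
    have h := hgle i q q.2
    rw [partialSum_succ]
    linarith
  have hconc : ∀ i j : Fin n, (j : ℕ) = i + 1 → g j + g j ≥ g i + g (j + 1) := by
    intro i j hij
    have key : (g i + g (j + 1)) / 2 ≤ g j := le_ciInf fun q => by
      have h1 := hgle i q q.2
      have h2 := hgle (j + 1) q q.2
      have h3 := partialSum_succ q.1 i
      have h4 := partialSum_succ q.1 j
      rw [← hij] at h3
      have h5 : q.1 j ≤ q.1 i := (hUd _ q.2).1 (Fin.le_def.mpr (by omega))
      linarith
    linarith
  set x : Fin n → ℝ := fun i => g (i + 1) - g i with hx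
  have hxd : DecrNonneg x := by
    refine ⟨?_, fun i => sub_nonneg.mpr (hmono i)⟩
    cases n with
    | zero => exact fun i => i.elim0
    | succ m =>
      refine Fin.antitone_iff_succ_le.mpr fun i => ?_
      have h := hconc i.castSucc i.succ (by simp)
      simp only [hx, Fin.val_succ, Fin.val_castSucc] at h ⊢
      linarith
  have hxk : ∀ k ≤ n, partialSum x k = g k := fun k hk => by
    rw [hx, partialSum_eq_sum_range (fun i => g (i + 1) - g i) hk, Finset.sum_range_sub, hg0,
      sub_zero]
  have hub : ∀ s ∈ S, WeakMaj s x := fun s hs => by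
    rw [weakMaj_iff_partialSum (hS s hs) hxd]
    intro k hk1 hk
    rw [hxk k hk]
    exact le_ciInf fun q => (weakMaj_iff_partialSum (hS s hs) (hUd _ q.2)).mp
      (((hU _).mp q.2).2 s hs) k hk1 hk
  have hlb : ∀ q ∈ U, WeakMaj x q := fun q hq => by
    rw [weakMaj_iff_partialSum hxd (hUd q hq)]
    intro k _ hk
    rw [hxk k hk]
    exact hgle k q hq
  have hxU : x ∈ U := (hU x).mpr ⟨hxd, hub⟩
  refine ⟨x, ⟨hxd, hub, fun p hp hpS => ?_⟩, hxU, hxd, hlb, fun p _ hpU => hpU x hxU⟩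
  refine weakMaj_decrRearrange_right.mp (hlb _ ((hU _).mpr ⟨decrNonneg_decrRearrange hp, ?_⟩))
  exact fun s hs => weakMaj_decrRearrange_right.mpr (hpS s hs)

/-- The Hermitian matrix `U diag(d) U*`. -/
def unitaryDiag {n : ℕ} (U : Matrix (Fin n) (Fin n) ℂ) (d : Fin n → ℝ) :
    Matrix (Fin n) (Fin n) ℂ :=
  U * diagonal (fun i => (d i : ℂ)) * star U

lemma unitaryDiag_apply {n : ℕ} (U : Matrix (Fin n) (Fin n) ℂ) (d : Fin n → ℝ) (i j : Fin n) :
    unitaryDiag U d i j = ∑ m, U i m * d m * star (U j m) := by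
  rw [unitaryDiag, Matrix.mul_apply]
  simp [Matrix.mul_diagonal]

lemma isHermitian_unitaryDiag {n : ℕ} (U : Matrix (Fin n) (Fin n) ℂ) (d : Fin n → ℝ) :
    (unitaryDiag U d).IsHermitian := by
  have h : star (diagonal fun i => (d i : ℂ)) = diagonal fun i => (d i : ℂ) := by
    rw [star_eq_conjTranspose, diagonal_conjTranspose]
    congr 1
    ext i
    simp
  rw [IsHermitian, ← star_eq_conjTranspose, unitaryDiag, star_mul, star_mul, star_star, h,
    mul_assoc]

lemma unitaryDiag_mul {n : ℕ} {U : Matrix (Fin n) (Fin n) ℂ} (hU : U ∈ unitaryGroup (Fin n) ℂ)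
    (d e : Fin n → ℝ) : unitaryDiag U d * unitaryDiag U e = unitaryDiag U (d * e) := by
  have h := mem_unitaryGroup_iff'.mp hU
  calc unitaryDiag U d * unitaryDiag U e
      = U * diagonal (fun i => (d i : ℂ)) * (star U * U) * diagonal (fun i => (e i : ℂ))
        * star U := by simp only [unitaryDiag, mul_assoc]
    _ = U * (diagonal (fun i => (d i : ℂ)) * diagonal (fun i => (e i : ℂ))) * star U := by
        rw [h]; simp only [mul_assoc, one_mul]
    _ = unitaryDiag U (d * e) := by
        rw [diagonal_mul_diagonal, unitaryDiag]; simp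

lemma unitaryDiag_one {n : ℕ} {U : Matrix (Fin n) (Fin n) ℂ} (hU : U ∈ unitaryGroup (Fin n) ℂ) :
    unitaryDiag U 1 = 1 := by
  have h := mem_unitaryGroup_iff.mp hU
  simp [unitaryDiag, h]

lemma unitaryDiag_sum_smul {n : ℕ} {ι : Type*} (s : Finset ι) (U : Matrix (Fin n) (Fin n) ℂ)
    (c : ι → ℝ) (d : ι → Fin n → ℝ) :
    unitaryDiag U (fun i => ∑ r ∈ s, c r * d r i) = ∑ r ∈ s, c r • unitaryDiag U (d r) := by
  ext i j
  simp only [Matrix.sum_apply, Matrix.smul_apply, unitaryDiag_apply, Complex.ofReal_sum,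
    Finset.mul_sum, Finset.sum_mul, Finset.smul_sum]
  rw [Finset.sum_comm]
  refine Finset.sum_congr rfl fun r _ => Finset.sum_congr rfl fun m _ => ?_
  rw [Complex.real_smul]
  push_cast
  ring

lemma trace_unitaryDiag {n : ℕ} {U : Matrix (Fin n) (Fin n) ℂ} (hU : U ∈ unitaryGroup (Fin n) ℂ)
    (d : Fin n → ℝ) : (unitaryDiag U d).trace = ∑ i, (d i : ℂ) := by
  rw [unitaryDiag, trace_mul_comm, ← mul_assoc, mem_unitaryGroup_iff'.mp hU, one_mul,
    trace_diagonal]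

/-- The squared moduli of the inner products between the columns of `U` and of `V`. -/
noncomputable def overlap {n : ℕ} (U V : Matrix (Fin n) (Fin n) ℂ) (i j : Fin n) : ℝ :=
  Complex.normSq ((star U * V) i j)

lemma overlap_nonneg {n : ℕ} (U V : Matrix (Fin n) (Fin n) ℂ) (i j : Fin n) :
    0 ≤ overlap U V i j := Complex.normSq_nonneg _

lemma sum_normSq_row {n : ℕ} {W : Matrix (Fin n) (Fin n) ℂ} (hW : W ∈ unitaryGroup (Fin n) ℂ)
    (i : Fin n) : ∑ j, Complex.normSq (W i j) = 1 := by
  have h := congrFun (congrFun (mem_unitaryGroup_iff.mp hW) i) i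
  rw [Matrix.mul_apply, one_apply_eq] at h
  simp only [star_apply, Complex.star_def, Complex.mul_conj] at h
  exact_mod_cast h

lemma sum_overlap_right {n : ℕ} {U V : Matrix (Fin n) (Fin n) ℂ}
    (hU : U ∈ unitaryGroup (Fin n) ℂ) (hV : V ∈ unitaryGroup (Fin n) ℂ) (i : Fin n) :
    ∑ j, overlap U V i j = 1 :=
  sum_normSq_row (mul_mem (Unitary.star_mem hU) hV) i

lemma overlap_comm {n : ℕ} (U V : Matrix (Fin n) (Fin n) ℂ) (i j : Fin n) :
    overlap U V i j = overlap V U j i := by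
  have h : star U * V = star (star V * U) := by rw [star_mul, star_star]
  rw [overlap, h, star_apply, Complex.star_def, Complex.normSq_conj, overlap]

lemma sum_overlap_left {n : ℕ} {U V : Matrix (Fin n) (Fin n) ℂ}
    (hU : U ∈ unitaryGroup (Fin n) ℂ) (hV : V ∈ unitaryGroup (Fin n) ℂ) (j : Fin n) :
    ∑ i, overlap U V i j = 1 := by
  simp only [overlap_comm U V]
  exact sum_overlap_right hV hU j

lemma trace_unitaryDiag_mul_unitaryDiag {n : ℕ} (U V : Matrix (Fin n) (Fin n) ℂ)
    (d e : Fin n → ℝ) :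
    (unitaryDiag U d * unitaryDiag V e).trace =
      ((∑ i, ∑ j, d i * e j * overlap U V i j : ℝ) : ℂ) := by
  set W := star U * V with hW
  have hW' : star V * U = star W := by rw [hW, star_mul, star_star]
  have h : (unitaryDiag U d * unitaryDiag V e).trace
      = (diagonal (fun i => (d i : ℂ)) * W * (diagonal (fun i => (e i : ℂ)) * star W)).trace := by
    rw [← hW', hW, unitaryDiag, mul_assoc, mul_assoc, trace_mul_comm, unitaryDiag]
    simp only [mul_assoc]
  rw [h, trace]
  push_cast
  refine Finset.sum_congr rfl fun i _ => ?_
  rw [diag_apply, Matrix.mul_apply]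
  refine Finset.sum_congr rfl fun j _ => ?_
  rw [diagonal_mul, diagonal_mul, star_apply, overlap, ← hW, ← Complex.mul_conj]
  simp only [Complex.star_def]
  ring

lemma absSpecVec_eq {n : ℕ} {X : Matrix (Fin n) (Fin n) ℂ} (hX : X.IsHermitian) :
    absSpecVec X = decrRearrange fun i => |hX.eigenvalues i| := dif_pos hX

lemma decrNonneg_absSpecVec {n : ℕ} (X : Matrix (Fin n) (Fin n) ℂ) :
    DecrNonneg (absSpecVec X) := by
  by_cases hX : X.IsHermitian
  · rw [absSpecVec_eq hX]
    exact decrNonneg_decrRearrange fun i => abs_nonneg _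
  · rw [absSpecVec, dif_neg hX]
    exact ⟨fun _ _ _ => le_rfl, fun _ => le_rfl⟩

/-- A spectral decomposition of `X` with the absolute eigenvalues in decreasing order and the
signs separated. -/
lemma exists_eq_unitaryDiag {n : ℕ} {X : Matrix (Fin n) (Fin n) ℂ} (hX : X.IsHermitian) :
    ∃ U ∈ unitaryGroup (Fin n) ℂ, ∃ σ : Fin n → ℝ, σ * σ = 1 ∧
      X = unitaryDiag U (σ * absSpecVec X) := by
  set U : Matrix (Fin n) (Fin n) ℂ := hX.eigenvectorUnitary.1 with hU
  have hUm : U ∈ unitaryGroup (Fin n) ℂ := hX.eigenvectorUnitary.2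
  set π : Equiv.Perm (Fin n) :=
    Fin.revPerm.trans (Tuple.sort fun i => |hX.eigenvalues i|) with hπ
  have hperm : ∀ d : Fin n → ℝ, unitaryDiag (U.submatrix id π) (d ∘ π) = unitaryDiag U d := by
    intro d
    ext i j
    simp only [unitaryDiag_apply, submatrix_apply, id, Function.comp]
    exact Equiv.sum_comp π fun m => U i m * d m * star (U j m)
  refine ⟨U.submatrix id π, ?_, fun i => if 0 ≤ hX.eigenvalues (π i) then 1 else -1, ?_, ?_⟩
  · rw [mem_unitaryGroup_iff]
    have h1 := hperm 1
    rw [unitaryDiag_one hUm] at h1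
    rw [← h1, unitaryDiag]
    simp
  · ext i
    simp only [Pi.mul_apply, Pi.one_apply]
    split_ifs <;> norm_num
  · have hd : ((fun i => if 0 ≤ hX.eigenvalues (π i) then 1 else -1) * absSpecVec X)
        = hX.eigenvalues ∘ π := by
      ext i
      rw [absSpecVec_eq hX, decrRearrange_eq_comp, ← hπ]
      simp only [Pi.mul_apply, Function.comp]
      split_ifs with h
      · rw [abs_of_nonneg h, one_mul]
      · rw [abs_of_neg (not_le.mp h)]
        ring
    rw [hd, hperm]
    conv_lhs => rw [hX.spectral_theorem, Unitary.conjStarAlgAut_apply]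
    rfl

lemma abs_apply_eq_one {ι : Type*} {σ : ι → ℝ} (hσ : σ * σ = 1) (i : ι) : |σ i| = 1 := by
  rcases mul_self_eq_one_iff.mp (congrFun hσ i) with h | h <;> simp [h]

/-- The sign vector `σ` truncated to its first `k` entries. -/
def truncate {n : ℕ} (σ : Fin n → ℝ) (k : ℕ) : Fin n → ℝ :=
  fun i => if (i : ℕ) < k then σ i else 0

lemma sum_abs_truncate_mul {n : ℕ} {σ : Fin n → ℝ} (hσ : σ * σ = 1) (f : Fin n → ℝ) (k : ℕ) :
    ∑ i, |truncate σ k i| * f i = partialSum f k := by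
  refine Finset.sum_congr rfl fun i _ => ?_
  have h := abs_apply_eq_one hσ i
  unfold truncate
  split_ifs <;> simp [h]

lemma exists_jmul_eq_unitaryDiag_truncate {n k : ℕ} (hn : 0 < n) (hk : 1 ≤ k)
    {U : Matrix (Fin n) (Fin n) ℂ} (hU : U ∈ unitaryGroup (Fin n) ℂ) {σ : Fin n → ℝ}
    (hσ : σ * σ = 1) :
    ∃ P ε, IsProjection P ∧ IsInvolution ε ∧ unitaryDiag U (truncate σ k) = jmul P ε := by
  refine ⟨unitaryDiag U (truncate 1 k), unitaryDiag U σ,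
    ⟨isHermitian_unitaryDiag _ _, ?_, ?_⟩, ⟨isHermitian_unitaryDiag _ _, ?_⟩, ?_⟩
  · rw [unitaryDiag_mul hU]
    congr 1
    ext i
    simp [truncate]
  · intro h
    have h1 := trace_unitaryDiag hU (truncate 1 k)
    rw [h, trace_zero] at h1
    have h2 : (0 : ℝ) = ∑ i, truncate (1 : Fin n → ℝ) k i := by exact_mod_cast h1
    have h3 : (1 : ℝ) ≤ ∑ i, truncate (1 : Fin n → ℝ) k i := by
      have h4 : truncate (1 : Fin n → ℝ) k ⟨0, hn⟩ = 1 := if_pos hk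
      rw [← h4]
      refine Finset.single_le_sum (f := truncate (1 : Fin n → ℝ) k) (fun i _ => ?_)
        (Finset.mem_univ _)
      unfold truncate
      split_ifs <;> simp
    linarith
  · rw [unitaryDiag_mul hU, hσ, unitaryDiag_one hU]
  · rw [jmul, unitaryDiag_mul hU, unitaryDiag_mul hU, mul_comm σ, ← two_smul ℂ, smul_smul]
    norm_num
    congr 1
    ext i
    simp [truncate]

lemma trace_mul_truncate_le {n k : ℕ} (hk : k ≤ n) {Y : Matrix (Fin n) (Fin n) ℂ}
    (hY : Y.IsHermitian) {V : Matrix (Fin n) (Fin n) ℂ} (hV : V ∈ unitaryGroup (Fin n) ℂ)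
    {τ : Fin n → ℝ} (hτ : τ * τ = 1) :
    (Y * unitaryDiag V (truncate τ k)).trace.re ≤ partialSum (absSpecVec Y) k := by
  obtain ⟨U, hU, σ, hσ, hYU⟩ := exists_eq_unitaryDiag hY
  set a := absSpecVec Y
  have ha : DecrNonneg a := decrNonneg_absSpecVec Y
  have hσ1 := abs_apply_eq_one hσ
  rw [hYU, trace_unitaryDiag_mul_unitaryDiag, Complex.ofReal_re]
  calc ∑ i, ∑ j, (σ * a) i * truncate τ k j * overlap U V i j
      ≤ ∑ i, a i * ∑ j, |truncate τ k j| * overlap U V i j := by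
        refine Finset.sum_le_sum fun i _ => ?_
        rw [Finset.mul_sum]
        refine Finset.sum_le_sum fun j _ => ?_
        rw [← mul_assoc]
        refine mul_le_mul_of_nonneg_right ?_ (overlap_nonneg _ _ _ _)
        refine (le_abs_self _).trans_eq ?_
        rw [abs_mul, Pi.mul_apply, abs_mul, hσ1, one_mul, abs_of_nonneg (ha.2 i)]
    _ ≤ partialSum a k := by
        refine sum_mul_le_partialSum hk ha (fun i => ?_) (fun i => ?_) ?_
        · exact Finset.sum_nonneg fun j _ => mul_nonneg (abs_nonneg _) (overlap_nonneg _ _ _ _)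
        · rw [sum_abs_truncate_mul hτ, ← sum_overlap_right hU hV i, ← partialSum_self]
          refine Finset.sum_le_sum fun j _ => ?_
          split_ifs <;> simp_all [overlap_nonneg]
        · rw [Finset.sum_comm]
          simp only [← Finset.mul_sum, sum_overlap_left hU hV]
          rw [sum_abs_truncate_mul hτ, partialSum_one hk]

/-- The sum of the `k` largest absolute eigenvalues is attained as a trace. -/
lemma exists_trace_mul_truncate_eq {n : ℕ} {Y : Matrix (Fin n) (Fin n) ℂ} (hY : Y.IsHermitian) :
    ∃ V ∈ unitaryGroup (Fin n) ℂ, ∃ τ : Fin n → ℝ, τ * τ = 1 ∧ ∀ k,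
      (Y * unitaryDiag V (truncate τ k)).trace.re = partialSum (absSpecVec Y) k := by
  obtain ⟨U, hU, σ, hσ, hYU⟩ := exists_eq_unitaryDiag hY
  refine ⟨U, hU, σ, hσ, fun k => ?_⟩
  set a := absSpecVec Y
  rw [hYU, unitaryDiag_mul hU, trace_unitaryDiag hU, ← Complex.ofReal_sum, Complex.ofReal_re]
  refine Finset.sum_congr rfl fun i _ => ?_
  have h : σ i * σ i = 1 := congrFun hσ i
  simp only [Pi.mul_apply, truncate]
  split_ifs
  · linear_combination a i * h
  · simp

lemma trace_mul_le_sum_of_absSpecVec_le_one {n : ℕ} {X Y : Matrix (Fin n) (Fin n) ℂ}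
    (hX : X.IsHermitian) (hX1 : ∀ i, absSpecVec X i ≤ 1) (hY : Y.IsHermitian) :
    (X * Y).trace.re ≤ partialSum (absSpecVec Y) n := by
  obtain ⟨U, hU, σ, hσ, hXU⟩ := exists_eq_unitaryDiag hX
  obtain ⟨V, hV, τ, hτ, hYV⟩ := exists_eq_unitaryDiag hY
  set a := absSpecVec X
  set b := absSpecVec Y
  have ha : DecrNonneg a := decrNonneg_absSpecVec X
  have hb : DecrNonneg b := decrNonneg_absSpecVec Y
  have hσ1 := abs_apply_eq_one hσ
  have hτ1 := abs_apply_eq_one hτ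
  rw [hXU, hYV, trace_unitaryDiag_mul_unitaryDiag, Complex.ofReal_re, Finset.sum_comm,
    partialSum_self]
  refine Finset.sum_le_sum fun j _ => ?_
  calc ∑ i, (σ * a) i * (τ * b) j * overlap U V i j ≤ ∑ i, b j * overlap U V i j := by
        refine Finset.sum_le_sum fun i _ => ?_
        refine mul_le_mul_of_nonneg_right ?_ (overlap_nonneg _ _ _ _)
        refine (le_abs_self _).trans ?_
        rw [abs_mul, Pi.mul_apply, Pi.mul_apply, abs_mul, abs_mul, hσ1, hτ1, one_mul, one_mul,
          abs_of_nonneg (ha.2 i), abs_of_nonneg (hb.2 j)]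
        exact mul_le_of_le_one_left (hb.2 j) (hX1 i)
    _ = b j := by rw [← Finset.mul_sum, sum_overlap_left hU hV, mul_one]

lemma sum_absSpecVec_truncate_le {n k : ℕ} (hk : k ≤ n) {U : Matrix (Fin n) (Fin n) ℂ}
    (hU : U ∈ unitaryGroup (Fin n) ℂ) {σ : Fin n → ℝ} (hσ : σ * σ = 1) :
    ∑ i, absSpecVec (unitaryDiag U (truncate σ k)) i ≤ k := by
  obtain ⟨V, hV, τ, hτ, h⟩ := exists_trace_mul_truncate_eq
    (isHermitian_unitaryDiag U (truncate σ k))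
  rw [← partialSum_self, ← h n, trace_unitaryDiag_mul_unitaryDiag, Complex.ofReal_re]
  have hτ1 := abs_apply_eq_one hτ
  calc ∑ i, ∑ j, truncate σ k i * truncate τ n j * overlap U V i j
      ≤ ∑ i, |truncate σ k i| * ∑ j, overlap U V i j := by
        refine Finset.sum_le_sum fun i _ => ?_
        rw [Finset.mul_sum]
        refine Finset.sum_le_sum fun j _ => ?_
        refine mul_le_mul_of_nonneg_right ((le_abs_self _).trans_eq ?_) (overlap_nonneg _ _ _ _)
        rw [abs_mul]
        simp [truncate, hτ1]
    _ = k := by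
        simp only [sum_overlap_right hU hV]
        rw [sum_abs_truncate_mul hσ, partialSum_one hk]

open scoped Matrix.Norms.L2Operator in
lemma absSpecVec_le_norm {n : ℕ} {X : Matrix (Fin n) (Fin n) ℂ} (hX : X.IsHermitian)
    (i : Fin n) : absSpecVec X i ≤ ‖X‖ := by
  have : Nonempty (Fin n) := ⟨i⟩
  rw [absSpecVec_eq hX]
  exact spectrum.norm_le_norm_of_mem (hX.eigenvalues_mem_spectrum_real _)

lemma isHermitian_jmul {n : ℕ} {X Y : Matrix (Fin n) (Fin n) ℂ} (hX : X.IsHermitian)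
    (hY : Y.IsHermitian) : (jmul X Y).IsHermitian := by
  rw [IsHermitian, jmul, conjTranspose_smul, conjTranspose_add, conjTranspose_mul,
    conjTranspose_mul, hX.eq, hY.eq, add_comm]
  simp

open scoped Matrix.Norms.L2Operator in
lemma norm_jmul_le_one {n : ℕ} {P ε : Matrix (Fin n) (Fin n) ℂ}
    (hP : IsProjection P) (hε : IsInvolution ε) : ‖jmul P ε‖ ≤ 1 := by
  have hPn : ‖P‖ ≤ 1 := IsStarProjection.norm_le P ⟨hP.2.1, hP.1⟩
  have hεn : ‖ε‖ ≤ 1 := by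
    have h : ‖ε‖ * ‖ε‖ ≤ 1 := by
      rw [← CStarRing.norm_star_mul_self, star_eq_conjTranspose, hε.1.eq, hε.2]
      exact IsStarProjection.norm_le 1 ⟨mul_one _, star_one _⟩
    nlinarith [norm_nonneg ε]
  have h1 : ‖P * ε‖ ≤ 1 := (norm_mul_le _ _).trans (mul_le_one₀ hPn (norm_nonneg _) hεn)
  have h2 : ‖ε * P‖ ≤ 1 := (norm_mul_le _ _).trans (mul_le_one₀ hεn (norm_nonneg _) hPn)
  have h3 := norm_add_le (P * ε) (ε * P)
  rw [jmul, norm_smul]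
  norm_num
  linarith

lemma absSpecVec_jmul_le_one {n : ℕ} {P ε : Matrix (Fin n) (Fin n) ℂ}
    (hP : IsProjection P) (hε : IsInvolution ε) (i : Fin n) : absSpecVec (jmul P ε) i ≤ 1 :=
  (absSpecVec_le_norm (isHermitian_jmul hP.1 hε.1) i).trans (norm_jmul_le_one hP hε)

open scoped Matrix.Norms.L2Operator in
lemma exists_absSpecVec_map_jmul_le {n : ℕ}
    {T : Matrix (Fin n) (Fin n) ℂ → Matrix (Fin n) (Fin n) ℂ} (hTlin : IsLinearMap ℝ T)
    (hT : ∀ X : Matrix (Fin n) (Fin n) ℂ, X.IsHermitian → (T X).IsHermitian) :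
    ∃ C : ℝ, ∀ P ε : Matrix (Fin n) (Fin n) ℂ, IsProjection P → IsInvolution ε →
      ∀ i, absSpecVec (T (jmul P ε)) i ≤ C := by
  set L := (hTlin.mk' T).toContinuousLinearMap
  refine ⟨‖L‖, fun P ε hP hε i => ?_⟩
  calc absSpecVec (T (jmul P ε)) i ≤ ‖L (jmul P ε)‖ :=
        absSpecVec_le_norm (hT _ (isHermitian_jmul hP.1 hε.1)) i
    _ ≤ ‖L‖ * ‖jmul P ε‖ := L.le_opNorm _
    _ ≤ ‖L‖ := mul_le_of_le_one_right (norm_nonneg _) (norm_jmul_le_one hP hε)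

lemma sum_range_sub_mul_ite (g : ℕ → ℝ) (n i : ℕ) :
    ∑ r ∈ Finset.range n, (g r - g (r + 1)) * (if i < r + 1 then 1 else 0)
      = if i < n then g i - g n else 0 := by
  induction n with
  | zero => simp
  | succ n ih =>
    rw [Finset.sum_range_succ, ih]
    rcases lt_trichotomy i n with h | rfl | h
    · simp [h, Nat.lt_succ_of_lt h]
    · simp
    · simp [not_lt.mpr h.le, not_lt.mpr (Nat.succ_le_of_lt h)]

/-- Every decreasing nonnegative vector is a nonnegative combination of indicators of initial
segments. -/
lemma DecrNonneg.exists_eq_sum {n : ℕ} {a : Fin n → ℝ} (ha : DecrNonneg a) :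
    ∃ c : ℕ → ℝ, (∀ r, 0 ≤ c r) ∧
      ∀ i : Fin n, a i = ∑ r ∈ Finset.range n, c r * (if (i : ℕ) < r + 1 then 1 else 0) := by
  set g : ℕ → ℝ := fun j => if h : j < n then a ⟨j, h⟩ else 0 with hg
  refine ⟨fun r => g r - g (r + 1), fun r => ?_, fun i => ?_⟩
  · rw [sub_nonneg]
    simp only [hg]
    split_ifs with h1 h2 h2
    · exact ha.1 (Fin.le_def.mpr (Nat.le_succ r))
    · omega
    · exact ha.2 _
    · exact le_rfl
  · rw [sum_range_sub_mul_ite]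
    simp [hg]

lemma trace_mul_truncate_le_of_forall_weakMaj {n : ℕ} (hn : 0 < n)
    {T T' : Matrix (Fin n) (Fin n) ℂ → Matrix (Fin n) (Fin n) ℂ}
    (hT : ∀ X : Matrix (Fin n) (Fin n) ℂ, X.IsHermitian → (T X).IsHermitian)
    (hT' : ∀ X : Matrix (Fin n) (Fin n) ℂ, X.IsHermitian → (T' X).IsHermitian)
    (hadj : IsAdjointOf T' T) {q : Fin n → ℝ} (hq : DecrNonneg q)
    (hub : ∀ s ∈ lambdaSet T T', WeakMaj s q) {k r : ℕ} (hk1 : 1 ≤ k) (hk : k ≤ n)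
    (hr1 : 1 ≤ r) (hr : r ≤ n) {U V : Matrix (Fin n) (Fin n) ℂ}
    (hU : U ∈ unitaryGroup (Fin n) ℂ) (hV : V ∈ unitaryGroup (Fin n) ℂ) {σ τ : Fin n → ℝ}
    (hσ : σ * σ = 1) (hτ : τ * τ = 1) :
    (T (unitaryDiag U (truncate σ r)) * unitaryDiag V (truncate τ k)).trace.re
      ≤ partialSum q (min k r) := by
  have hE := isHermitian_unitaryDiag U (truncate σ r)
  have hF := isHermitian_unitaryDiag V (truncate τ k)
  rcases le_total k r with h | h
  · rw [min_eq_left h]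
    obtain ⟨P, ε, hP, hε, hPε⟩ := exists_jmul_eq_unitaryDiag_truncate hn hr1 hU hσ
    refine (trace_mul_truncate_le hk (hT _ hE) hV hτ).trans ?_
    refine (weakMaj_iff_partialSum (decrNonneg_absSpecVec _) hq).mp (hub _ ?_) k hk1 hk
    exact ⟨P, ε, hP, hε, Or.inl (by rw [hPε])⟩
  · rw [min_eq_right h, hadj _ _ hE hF, trace_mul_comm]
    obtain ⟨P, ε, hP, hε, hPε⟩ := exists_jmul_eq_unitaryDiag_truncate hn hk1 hV hτ
    refine (trace_mul_truncate_le hr (hT' _ hF) hU hσ).trans ?_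
    refine (weakMaj_iff_partialSum (decrNonneg_absSpecVec _) hq).mp (hub _ ?_) r hr1 hr
    exact ⟨P, ε, hP, hε, Or.inr (by rw [hPε])⟩

lemma weakMaj_map_of_forall_weakMaj {n : ℕ} (hn : 0 < n)
    {T T' : Matrix (Fin n) (Fin n) ℂ → Matrix (Fin n) (Fin n) ℂ} (hTlin : IsLinearMap ℝ T)
    (hT : ∀ X : Matrix (Fin n) (Fin n) ℂ, X.IsHermitian → (T X).IsHermitian)
    (hT' : ∀ X : Matrix (Fin n) (Fin n) ℂ, X.IsHermitian → (T' X).IsHermitian)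
    (hadj : IsAdjointOf T' T) {q : Fin n → ℝ} (hq : DecrNonneg q)
    (hub : ∀ s ∈ lambdaSet T T', WeakMaj s q) {X : Matrix (Fin n) (Fin n) ℂ}
    (hX : X.IsHermitian) : WeakMaj (absSpecVec (T X)) (q * absSpecVec X) := by
  have ha := decrNonneg_absSpecVec X
  rw [weakMaj_iff_partialSum (decrNonneg_absSpecVec _) (hq.mul ha)]
  intro k hk1 hk
  obtain ⟨U, hU, σ, hσ, hXU⟩ := exists_eq_unitaryDiag hX
  obtain ⟨V, hV, τ, hτ, hTX⟩ := exists_trace_mul_truncate_eq (hT X hX)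
  obtain ⟨c, hc0, hc⟩ := ha.exists_eq_sum
  have hd : σ * absSpecVec X
      = fun i => ∑ r ∈ Finset.range n, c r * truncate σ (r + 1) i := by
    ext i
    rw [Pi.mul_apply, hc i, Finset.mul_sum]
    refine Finset.sum_congr rfl fun r _ => ?_
    unfold truncate
    split_ifs <;> ring
  have hTsum : T X = ∑ r ∈ Finset.range n, c r • T (unitaryDiag U (truncate σ (r + 1))) := by
    conv_lhs => rw [hXU, hd, unitaryDiag_sum_smul]
    rw [← hTlin.mk'_apply, map_sum]
    simp only [map_smul, IsLinearMap.mk'_apply]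
  rw [← hTX k, hTsum, Finset.sum_mul, trace_sum, Complex.re_sum]
  calc ∑ r ∈ Finset.range n, (c r • T (unitaryDiag U (truncate σ (r + 1)))
          * unitaryDiag V (truncate τ k)).trace.re
      ≤ ∑ r ∈ Finset.range n, c r * partialSum q (min k (r + 1)) := by
        refine Finset.sum_le_sum fun r hr => ?_
        rw [smul_mul, trace_smul, Complex.smul_re]
        exact mul_le_mul_of_nonneg_left (trace_mul_truncate_le_of_forall_weakMaj hn hT hT' hadj
          hq hub hk1 hk r.succ_pos (Finset.mem_range.mp hr) hU hV hσ hτ) (hc0 r)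
    _ = partialSum (q * absSpecVec X) k := by
        unfold partialSum
        simp only [Finset.mul_sum]
        rw [Finset.sum_comm]
        refine Finset.sum_congr rfl fun i _ => ?_
        rw [Pi.mul_apply, hc i, Finset.mul_sum]
        split_ifs with hik
        · refine Finset.sum_congr rfl fun r _ => ?_
          simp only [lt_min_iff, hik, true_and]
          split_ifs <;> ring
        · simp [hik]

lemma weakMaj_of_mem_ineqSet {n : ℕ} (hn : 0 < n)
    {T T' : Matrix (Fin n) (Fin n) ℂ → Matrix (Fin n) (Fin n) ℂ}
    (hT : ∀ X : Matrix (Fin n) (Fin n) ℂ, X.IsHermitian → (T X).IsHermitian)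
    (hT' : ∀ X : Matrix (Fin n) (Fin n) ℂ, X.IsHermitian → (T' X).IsHermitian)
    (hadj : IsAdjointOf T' T) {q : Fin n → ℝ} (hqT : q ∈ ineqSet T) {s : Fin n → ℝ}
    (hs : s ∈ lambdaSet T T') : WeakMaj s q := by
  obtain ⟨hq, hqX⟩ := hqT
  obtain ⟨P, ε, hP, hε, hs⟩ := hs
  have hX := isHermitian_jmul hP.1 hε.1
  have hX1 := absSpecVec_jmul_le_one hP hε
  have hqk : ∀ {Y : Matrix (Fin n) (Fin n) ℂ}, Y.IsHermitian → ∀ k, 1 ≤ k → k ≤ n →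
      partialSum (absSpecVec (T Y)) k ≤ partialSum (q * absSpecVec Y) k := fun hY =>
    (weakMaj_iff_partialSum (decrNonneg_absSpecVec _)
      (hq.mul (decrNonneg_absSpecVec _))).mp (hqX _ hY)
  rcases hs with rfl | rfl <;>
    rw [weakMaj_iff_partialSum (decrNonneg_absSpecVec _) hq] <;> intro k hk1 hk
  · exact (hqk hX k hk1 hk).trans
      (partialSum_mono (fun i => mul_le_of_le_one_right (hq.2 i) (hX1 i)) k)
  · obtain ⟨V, hV, τ, hτ, htr⟩ := exists_trace_mul_truncate_eq (hT' _ hX)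
    have hE := isHermitian_unitaryDiag V (truncate τ k)
    obtain ⟨P', ε', hP', hε', hE'⟩ := exists_jmul_eq_unitaryDiag_truncate hn hk1 hV hτ
    have hE1 : ∀ i, absSpecVec (unitaryDiag V (truncate τ k)) i ≤ 1 := by
      rw [hE']
      exact absSpecVec_jmul_le_one hP' hε'
    rw [← htr k, trace_mul_comm, ← hadj _ _ hE hX, trace_mul_comm]
    calc _ ≤ partialSum (absSpecVec (T (unitaryDiag V (truncate τ k)))) n :=
          trace_mul_le_sum_of_absSpecVec_le_one hX hX1 (hT _ hE)
      _ ≤ partialSum (q * absSpecVec (unitaryDiag V (truncate τ k))) n := hqk hE n hn le_rfl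
      _ ≤ partialSum q k := by
          rw [partialSum_self]
          exact sum_mul_le_partialSum hk hq (decrNonneg_absSpecVec _).2 hE1
            (sum_absSpecVec_truncate_le hk hV hτ)

theorem wsup_eq_winf (n : ℕ) (hn : 0 < n) (T T' : Matrix (Fin n) (Fin n) ℂ → Matrix (Fin n) (Fin n) ℂ)
    (hTlin : IsLinearMap ℝ T) (hT'lin : IsLinearMap ℝ T')
    (hT : ∀ X : Matrix (Fin n) (Fin n) ℂ, X.IsHermitian → (T X).IsHermitian)
    (hT' : ∀ X : Matrix (Fin n) (Fin n) ℂ, X.IsHermitian → (T' X).IsHermitian)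
    (hadj : IsAdjointOf T' T) :
    (ineqSet T).Nonempty ∧ (lambdaSet T T').Nonempty ∧
    (∃ C : ℝ, ∀ s ∈ lambdaSet T T', ∀ i, s i ≤ C) ∧
    ∃ x : Fin n → ℝ, IsWSup (lambdaSet T T') x ∧ x ∈ ineqSet T ∧ IsWInf (ineqSet T) x := by
  have hmem : ∀ q, q ∈ ineqSet T ↔ DecrNonneg q ∧ ∀ s ∈ lambdaSet T T', WeakMaj s q :=
    fun q => ⟨fun hq => ⟨hq.1, fun s hs => weakMaj_of_mem_ineqSet hn hT hT' hadj hq hs⟩,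
      fun hq => ⟨hq.1, fun X hX =>
        weakMaj_map_of_forall_weakMaj hn hTlin hT hT' hadj hq.1 hq.2 hX⟩⟩
  have hdecr : ∀ s ∈ lambdaSet T T', DecrNonneg s := by
    rintro s ⟨P, ε, -, -, rfl | rfl⟩ <;> exact decrNonneg_absSpecVec _
  have : Nonempty (Fin n) := ⟨⟨0, hn⟩⟩
  have hlambda : (lambdaSet T T').Nonempty :=
    ⟨_, 1, 1, ⟨isHermitian_one, one_mul 1, one_ne_zero⟩, ⟨isHermitian_one, one_mul 1⟩,
      Or.inl rfl⟩
  obtain ⟨C₁, hC₁⟩ := exists_absSpecVec_map_jmul_le hTlin hT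
  obtain ⟨C₂, hC₂⟩ := exists_absSpecVec_map_jmul_le hT'lin hT'
  have hbdd : ∀ s ∈ lambdaSet T T', ∀ i, s i ≤ max C₁ C₂ := by
    rintro s ⟨P, ε, hP, hε, rfl | rfl⟩ i
    exacts [(hC₁ P ε hP hε i).trans (le_max_left _ _),
      (hC₂ P ε hP hε i).trans (le_max_right _ _)]
  have hC : 0 ≤ max C₁ C₂ := by
    obtain ⟨s, hs⟩ := hlambda
    exact ((hdecr s hs).2 ⟨0, hn⟩).trans (hbdd s hs _)
  have hconst : DecrNonneg fun _ : Fin n => max C₁ C₂ := ⟨fun _ _ _ => le_rfl, fun _ => hC⟩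
  have hineq : (ineqSet T).Nonempty :=
    ⟨_, (hmem _).mpr ⟨hconst, fun s hs =>
      (weakMaj_iff_partialSum (hdecr s hs) hconst).mpr
        fun k _ _ => partialSum_mono (hbdd s hs) k⟩⟩
  exact ⟨hineq, hlambda, ⟨_, hbdd⟩, exists_isWSup_isWInf hdecr hmem hineq⟩
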